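/- Let F be any field, N ≥ 1 and d ≥ 0. The map φ is an isomorphism of GL_2(F)-representations Sym^{N−1}E ⊗ ⋀^{N+1}Sym^{d+1}E ≅ det^N ⊗ Δ^{(2,1^{N−1})}Sym^d E: that is, φ is a linear bijection onto ker μ_N and φ(g·x) = det(g)^N · (g·φ(x)) for every g ∈ GL_2(F) and every x in the domain. -/

import Mathlib

open MvPolynomial TensorProduct

set_option maxHeartbeats 1000000
set_option synthInstance.maxHeartbeats 400000

noncomputable section

/-- `Sym' F c` : the `c`-th symmetric power of `E = F²`, realised as the space of
homogeneous polynomials of degree `c` in the two variables `X = X 0`, `Y = X 1`. -/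
abbrev Sym' (F : Type*) [Field F] (c : ℕ) : Type _ :=
  ↥(MvPolynomial.homogeneousSubmodule (Fin 2) F c)

variable (F : Type*) [Field F]

/-- The basis monomial `X^(c-i) Y^i` of `Sym' F c`; it is `0` (junk) if `i > c`. -/
def XY (c i : ℕ) : Sym' F c :=
  if h : i ≤ c then
    ⟨(X 0 : MvPolynomial (Fin 2) F) ^ (c - i) * X 1 ^ i, by
      rw [MvPolynomial.mem_homogeneousSubmodule]
      have := ((isHomogeneous_X_pow (R := F) (0 : Fin 2) (c - i)).mul
        (isHomogeneous_X_pow (R := F) (1 : Fin 2) i))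
      rwa [Nat.sub_add_cancel h] at this⟩
  else 0

/-- `F_∧^{(c)}(k) = X^{c-k₁}Y^{k₁} ∧ ⋯ ∧ X^{c-k_r}Y^{k_r}` in `⋀^r (Sym' F c)`. -/
def wedge (c : ℕ) {r : ℕ} (k : Fin r → ℕ) : ⋀[F]^r (Sym' F c) :=
  ⟨ExteriorAlgebra.ιMulti F r fun a => XY F c (k a),
    ExteriorAlgebra.ιMulti_range F r (Set.mem_range_self _)⟩

/-- `F(i,j) = F_∧^{(d)}(i) ⊗ X^{d-j}Y^j`. -/
def Fp (d : ℕ) {N : ℕ} (i : Fin N → ℕ) (j : ℕ) :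
    (⋀[F]^N (Sym' F d)) ⊗[F] (Sym' F d) :=
  wedge F d i ⊗ₜ[F] XY F d j

/-- The multiplication map `μ_N : ⋀^N V ⊗ V → ⋀^{N+1} V` for `V = Sym' F c`. -/
def mu (c N : ℕ) :
    ((⋀[F]^N (Sym' F c)) ⊗[F] (Sym' F c)) →ₗ[F] ⋀[F]^(N + 1) (Sym' F c) :=
  TensorProduct.lift
    (LinearMap.mk₂ F
      (fun w v => ⟨(w : ExteriorAlgebra F (Sym' F c)) * ExteriorAlgebra.ι F v, by
        have h := Submodule.mul_mem_mul w.2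
          (LinearMap.mem_range_self (ExteriorAlgebra.ι F (M := Sym' F c)) v)
        rwa [← pow_succ] at h⟩)
      (fun w w' v => by ext; simp [add_mul])
      (fun a w v => by ext; simp [mul_assoc, Algebra.smul_mul_assoc])
      (fun w v v' => by ext; simp [mul_add])
      (fun a w v => by ext; simp [Algebra.mul_smul_comm]))

/-- The box `B(k) = [k₁,k₂) × ⋯ × [k_N, k_{N+1})` as a finset of multi-indices. -/
def box {N : ℕ} (k : Fin (N + 1) → ℕ) : Finset (Fin N → ℕ) :=
  Fintype.piFinset fun a : Fin N => Finset.Ico (k a.castSucc) (k a.succ)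

/-- `v_{(s,k)} = Σ_{i ∈ B(k)} F(i, s + |k| - N - |i|)`. -/
def vv (d N : ℕ) (s : ℕ) (k : Fin (N + 1) → ℕ) :
    (⋀[F]^N (Sym' F d)) ⊗[F] (Sym' F d) :=
  ∑ i ∈ box k, Fp F d i (s + (∑ a, k a) - N - ∑ a, i a)

/-- A pair `(i, j)` is semistandard (with entries in `{0,…,d}`). -/
def IsSS (d : ℕ) {N : ℕ} (p : (Fin N → ℕ) × ℕ) : Prop :=
  StrictMono p.1 ∧ (∀ a, p.1 a ≤ d) ∧ p.2 ≤ d ∧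
    ∀ a : Fin N, (a : ℕ) = 0 → p.1 a ≤ p.2

/-- The neighbour map `P`. -/
def Pmap {N : ℕ} (p : (Fin N → ℕ) × ℕ) : (Fin N → ℕ) × ℕ :=
  if h : (Finset.univ.filter fun a : Fin N => p.1 a ≤ p.2).Nonempty then
    let α := (Finset.univ.filter fun a : Fin N => p.1 a ≤ p.2).max' h
    (Function.update p.1 α p.2, p.1 α)
  else p

/-- `F_Δ(i,j)`. -/
def FDelta (d : ℕ) {N : ℕ} (p : (Fin N → ℕ) × ℕ) :
    (⋀[F]^N (Sym' F d)) ⊗[F] (Sym' F d) :=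
  if ∃ a, p.1 a = p.2 then Fp F d p.1 p.2
  else Fp F d p.1 p.2 + Fp F d (Pmap p).1 (Pmap p).2

/-- The content multiset of a pair. -/
def ssContent {N : ℕ} (p : (Fin N → ℕ) × ℕ) : Multiset ℕ :=
  p.2 ::ₘ Finset.univ.val.map p.1


/-- The algebra endomorphism of `F[X,Y]` given by the linear substitution
`X_j ↦ Σ_i g_{ij} X_i`, i.e. the action of the matrix `g` on polynomials. -/
def subst (g : Matrix (Fin 2) (Fin 2) F) :
    MvPolynomial (Fin 2) F →ₐ[F] MvPolynomial (Fin 2) F :=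
  aeval fun j => ∑ i, C (g i j) * X i

lemma subst_mem (g : Matrix (Fin 2) (Fin 2) F) (c : ℕ) :
    ∀ p ∈ homogeneousSubmodule (Fin 2) F c,
      subst F g p ∈ homogeneousSubmodule (Fin 2) F c := by
  intro p hp
  rw [mem_homogeneousSubmodule] at hp ⊢
  have h := hp.aeval (fun j => ∑ i, C (g i j) * X i)
    (fun j => IsHomogeneous.sum _ _ _ fun i _ => isHomogeneous_C_mul_X _ _)
  simpa [subst] using h

/-- The action of a `2 × 2` matrix on `Sym^c E`, by linear substitution of the variables. -/
def rhoSym (g : Matrix (Fin 2) (Fin 2) F) (c : ℕ) : Sym' F c →ₗ[F] Sym' F c :=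
  (subst F g).toLinearMap.restrict (subst_mem F g c)

lemma map_mem_exteriorPower {M : Type*} [AddCommGroup M] [Module F M] (f : M →ₗ[F] M) (r : ℕ)
    {x : ExteriorAlgebra F M} (hx : x ∈ ⋀[F]^r M) :
    ExteriorAlgebra.map f x ∈ ⋀[F]^r M := by
  rw [← ExteriorAlgebra.ιMulti_span_fixedDegree] at hx ⊢
  induction hx using Submodule.span_induction with
  | mem y hy =>
      obtain ⟨v, rfl⟩ := hy
      rw [ExteriorAlgebra.map_apply_ιMulti]
      exact Submodule.subset_span (Set.mem_range_self _)
  | zero => simp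
  | add y z _ _ hy hz => rw [map_add]; exact Submodule.add_mem _ hy hz
  | smul a y _ hy => rw [map_smul]; exact Submodule.smul_mem _ a hy

/-- The functorial action of a linear endomorphism of `Sym^c E` on `⋀^r Sym^c E`. -/
def rhoW (c r : ℕ) (f : Sym' F c →ₗ[F] Sym' F c) :
    ↥(⋀[F]^r (Sym' F c)) →ₗ[F] ↥(⋀[F]^r (Sym' F c)) :=
  (ExteriorAlgebra.map f).toLinearMap.restrict
    (fun _ hx => map_mem_exteriorPower F f r hx)

/-- The domain `Sym^{N-1} E ⊗ ⋀^{N+1} Sym^{d+1} E` of `φ`. -/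
abbrev Dom (N d : ℕ) : Type _ := (Sym' F (N - 1)) ⊗[F] ↥(⋀[F]^(N + 1) (Sym' F (d + 1)))

/-- The codomain `⋀^N Sym^d E ⊗ Sym^d E` of `φ`. -/
abbrev Cod (N d : ℕ) : Type _ := ↥(⋀[F]^N (Sym' F d)) ⊗[F] (Sym' F d)

/-- The action of a `2 × 2` matrix on `Sym^{N-1} E ⊗ ⋀^{N+1} Sym^{d+1} E`, by functoriality. -/
def rhoDom (N d : ℕ) (g : Matrix (Fin 2) (Fin 2) F) : Dom F N d →ₗ[F] Dom F N d :=
  TensorProduct.map (rhoSym F g (N - 1)) (rhoW F (d + 1) (N + 1) (rhoSym F g (d + 1)))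

/-- The action of a `2 × 2` matrix on `⋀^N Sym^d E ⊗ Sym^d E`, by functoriality. -/
def rhoCod (N d : ℕ) (g : Matrix (Fin 2) (Fin 2) F) : Cod F N d →ₗ[F] Cod F N d :=
  TensorProduct.map (rhoW F d N (rhoSym F g d)) (rhoSym F g d)


section Helpers

variable {F} {A : Type*} [CommRing A] [Algebra F A]

/-- Evaluation of a homogeneous polynomial at the point `(1, z)`. -/
def ev (c : ℕ) (z : A) : Sym' F c →ₗ[F] A :=
  (aeval (R := F) ![1, z]).toLinearMap ∘ₗ Submodule.subtype _

lemma ev_XY (c i : ℕ) (h : i ≤ c) (z : A) : ev c z (XY F c i) = z ^ i := by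
  simp [ev, XY, h]

/-- The alternating map underlying the alternant attached to points `P`. -/
def altDet (c r : ℕ) (P : Fin r → A) : Sym' F c [⋀^Fin r]→ₗ[F] A where
  toMultilinearMap := ((Matrix.detRowAlternating (R := A)
    (n := Fin r)).toMultilinearMap.restrictScalars F).compLinearMap
      (fun _ => LinearMap.pi fun a => ev c (P a))
  map_eq_zero_of_eq' := by
    intro v i j h hij
    exact (Matrix.detRowAlternating (R := A) (n := Fin r)).map_eq_zero_of_eq
      (fun b => (LinearMap.pi fun a => ev c (P a)) (v b)) (by simp [h]) hij

/-- The alternant attached to points `P`. -/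
def Psi (c r : ℕ) (P : Fin r → A) : ↥(⋀[F]^r (Sym' F c)) →ₗ[F] A :=
  exteriorPower.alternatingMapLinearEquiv (altDet c r P)

lemma Psi_iMulti (c r : ℕ) (P : Fin r → A) (v : Fin r → Sym' F c) :
    Psi c r P (exteriorPower.ιMulti F r v) = (Matrix.of fun b a => ev c (P a) (v b)).det := by
  rw [Psi, exteriorPower.alternatingMapLinearEquiv_apply_ιMulti]
  rfl

lemma wedge_eq (c r : ℕ) (k : Fin r → ℕ) :
    wedge F c k = exteriorPower.ιMulti F r (fun a => XY F c (k a)) := rfl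

lemma Psi_wedge (c r : ℕ) (P : Fin r → A) (k : Fin r → ℕ) (hk : ∀ a, k a ≤ c) :
    Psi c r P (wedge F c k) = (Matrix.of fun b a => P a ^ k b).det := by
  rw [wedge_eq, Psi_iMulti]
  simp [ev_XY, hk]

lemma key_det (N : ℕ) (k : Fin (N + 1) → ℕ) (hk : StrictMono k) (z : A) (Q : Fin N → A) :
    (Matrix.of fun b a => (Fin.cons z Q : Fin (N + 1) → A) a ^ k b).det
      = (∏ c, (Q c - z)) * ∑ i ∈ box k, z ^ ((∑ a, k a) - N - ∑ a, i a) *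
          (Matrix.of fun b a => Q a ^ i b).det := by
  have hlt : ∀ b : Fin N, k b.castSucc < k b.succ := fun b => hk (Fin.castSucc_lt_succ)
  set M : Matrix (Fin (N + 1)) (Fin (N + 1)) A :=
    Matrix.of fun b a => (Fin.cons z Q : Fin (N + 1) → A) a ^ k b with hM
  let B : Matrix (Fin (N + 1)) (Fin (N + 1)) A := Matrix.of (Fin.cons (fun a => M 0 a)
    (fun b' a => M b'.succ a - z ^ (k b'.succ - k b'.castSucc) * M b'.castSucc a))
  have hB0 : ∀ a, B 0 a = M 0 a := fun a => rfl
  have hBs : ∀ (b' : Fin N) a, B b'.succ a =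
    M b'.succ a - z ^ (k b'.succ - k b'.castSucc) * M b'.castSucc a := fun b a => rfl
  clear_value B
  have h1 : M.det = B.det := by
    apply Matrix.det_eq_of_forall_row_eq_smul_add_pred
      (fun b' => z ^ (k b'.succ - k b'.castSucc))
    · intro j; rw [hB0]
    · intro i j; rw [hBs]; ring
  have h2 : B.det = z ^ k 0 *
      (Matrix.of fun (b a : Fin N) => (Q a - z) * ∑ i ∈ Finset.Ico (k b.castSucc) (k b.succ),
        (Q a ^ i * z ^ (k b.succ - 1 - i))).det := by
    rw [Matrix.det_succ_column_zero, Fin.sum_univ_succ, Finset.sum_eq_zero]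
    · simp only [hB0, hM, Fin.val_zero, pow_zero, one_mul, add_zero, Matrix.of_apply,
        Fin.cons_zero]
      congr 2
      ext b a
      simp only [Matrix.submatrix_apply, Fin.succAbove_zero, hBs, hM, Matrix.of_apply,
        Fin.cons_succ]
      have hb := hlt b
      obtain ⟨n, hn⟩ := Nat.exists_eq_add_of_lt hb
      rw [Finset.sum_Ico_eq_sum_range]
      have h3 : k b.succ - k b.castSucc = n + 1 := by omega
      rw [h3, hn]
      have := (Commute.all (Q a) z).mul_geom_sum₂ (n + 1)
      rw [add_assoc, pow_add, mul_comm (z ^ (n+1)), ← mul_sub, ← this, mul_left_comm, Finset.mul_sum]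
      congr 1
      apply Finset.sum_congr rfl
      intro i hi
      rw [pow_add, mul_assoc]
      congr 3
      omega
    · intro i _
      simp only [hBs, hM, Matrix.of_apply, Fin.cons_zero, ← pow_add]
      rw [Nat.sub_add_cancel (hlt i).le]
      simp
  have h3 := Matrix.det_mul_row (fun a => Q a - z) (Matrix.of fun (b a : Fin N) =>
    ∑ i ∈ Finset.Ico (k b.castSucc) (k b.succ), (Q a ^ i * z ^ (k b.succ - 1 - i)))
  simp only [Matrix.of_apply] at h3
  rw [h1, h2, h3]
  rw [mul_left_comm]
  congr 1
  have h4 : (Matrix.of fun (b a : Fin N) => ∑ i ∈ Finset.Ico (k b.castSucc) (k b.succ),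
        (Q a ^ i * z ^ (k b.succ - 1 - i))).det =
      ∑ i ∈ box k, (Matrix.of fun (b a : Fin N) => Q a ^ i b * z ^ (k b.succ - 1 - i b)).det := by
    have := (Matrix.detRowAlternating (R := A) (n := Fin N)).toMultilinearMap.map_sum_finset
      (fun b i => fun a => (Q a ^ i * z ^ (k b.succ - 1 - i)))
      (fun b => Finset.Ico (k b.castSucc) (k b.succ))
    refine Eq.trans ?_ this
    refine congrArg Matrix.det ?_
    ext b a
    simp
  rw [h4, Finset.mul_sum]
  apply Finset.sum_congr rfl
  intro i hi
  have hi' : ∀ b, i b < k b.succ := by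
    intro b
    have := Fintype.mem_piFinset.1 hi b
    exact (Finset.mem_Ico.1 this).2
  have h5 := Matrix.det_mul_column (fun b => z ^ (k b.succ - 1 - i b))
    (Matrix.of fun (b a : Fin N) => Q a ^ i b)
  have h6 : (Matrix.of fun (b a : Fin N) => Q a ^ i b * z ^ (k b.succ - 1 - i b)) =
    (Matrix.of fun (b a : Fin N) => z ^ (k b.succ - 1 - i b) *
      (Matrix.of fun (b a : Fin N) => Q a ^ i b) b a) := by
    ext; simp [mul_comm]
  rw [h6, h5, ← mul_assoc, Finset.prod_pow_eq_pow_sum, ← pow_add]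
  congr 2
  have h7 : ∑ b : Fin N, (k b.succ - 1 - i b) + N + ∑ b, i b = ∑ b : Fin N, k b.succ := by
    have h8 : ∑ b : Fin N, ((k b.succ - 1 - i b) + 1 + i b) = ∑ b : Fin N, k b.succ := by
      apply Finset.sum_congr rfl
      intro b _
      have := hi' b
      omega
    rw [← h8, Finset.sum_add_distrib, Finset.sum_add_distrib]
    simp
  rw [Fin.sum_univ_succ]
  omega

/-- The exponent vector of `X^(c-i) Y^i`. -/
def expo (c i : ℕ) : Fin 2 →₀ ℕ := Finsupp.single 0 (c - i) + Finsupp.single 1 i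

lemma XY_coe (c i : ℕ) (h : i ≤ c) :
    (XY F c i : MvPolynomial (Fin 2) F) = monomial (expo c i) 1 := by
  simp only [XY, h, dite_true, expo, X_pow_eq_monomial, monomial_mul, one_mul]

lemma expo_one (c i : ℕ) : expo c i 1 = i := by simp [expo]

lemma XY_linearIndependent (c : ℕ) :
    LinearIndependent F (fun i : Fin (c + 1) => XY F c i) := by
  rw [Fintype.linearIndependent_iff]
  intro g hg i
  have h := congrArg (fun p : Sym' F c => coeff (expo c i) (p : MvPolynomial (Fin 2) F)) hg
  simp only [Submodule.coe_sum, coeff_sum, Submodule.coe_smul, coeff_smul,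
    Submodule.coe_zero, coeff_zero] at h
  rw [Finset.sum_eq_single i] at h
  · rw [XY_coe _ _ (by omega)] at h
    simpa using h
  · intro j _ hj
    rw [XY_coe _ _ (by omega), coeff_monomial, if_neg, smul_zero]
    intro h
    apply hj
    have := congrArg (fun f => f 1) h
    simp only [expo_one] at this
    exact Fin.ext this
  · simp

lemma XY_span (c : ℕ) :
    ⊤ ≤ Submodule.span F (Set.range (fun i : Fin (c + 1) => XY F c i)) := by
  intro p _
  have hp : p = ∑ i : Fin (c + 1),
      coeff (expo c i) (p : MvPolynomial (Fin 2) F) • XY F c i := by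
    apply Subtype.ext
    ext m
    simp only [Submodule.coe_sum, coeff_sum, Submodule.coe_smul, coeff_smul]
    by_cases hm : m 0 + m 1 = c
    · rw [Finset.sum_eq_single (⟨m 1, by omega⟩ : Fin (c + 1))]
      · have : expo c (m 1) = m := by
          ext j
          fin_cases j
          · simp [expo]; omega
          · simp [expo]
        rw [XY_coe _ _ (by simp; omega)]
        simp [this]
      · intro j _ hj
        rw [XY_coe _ _ (by omega), coeff_monomial, if_neg, smul_zero]
        intro h
        apply hj
        apply Fin.ext
        simp [← h, expo_one]
      · simp
    · have h0 : coeff m (p : MvPolynomial (Fin 2) F) = 0 := by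
        by_contra h
        apply hm
        have h2 := (mem_homogeneousSubmodule _ _).1 p.2 h
        rw [← h2, Finsupp.weight_apply, Finsupp.sum_fintype _ _ (by simp)]
        simp
      rw [h0]
      symm
      apply Finset.sum_eq_zero
      intro j _
      rw [XY_coe _ _ (by omega), coeff_monomial, if_neg, smul_zero]
      intro h
      apply hm
      rw [← h]
      simp [expo]
      omega
  rw [hp]
  exact Submodule.sum_mem _ fun i _ => Submodule.smul_mem _ _
    (Submodule.subset_span (Set.mem_range_self i))

/-- The monomial basis of `Sym^c E`. -/
def symB (F : Type*) [Field F] (c : ℕ) : Module.Basis (Fin (c + 1)) F (Sym' F c) :=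
  Module.Basis.mk (XY_linearIndependent c) (XY_span c)

lemma symB_apply (c : ℕ) (i : Fin (c + 1)) : symB F c i = XY F c i := by
  simp [symB]

lemma wedgeB_apply (c r : ℕ) (s : Set.powersetCard (Fin (c + 1)) r) :
    (symB F c).exteriorPower r s =
      wedge F c (fun a => (Set.powersetCard.ofFinEmbEquiv.symm s a : ℕ)) := by
  rw [exteriorPower.basis_apply, exteriorPower.ιMulti_family, wedge_eq]
  congr 1
  ext1 a
  simp [symB_apply]

lemma Psi_map {B : Type*} [CommRing B] [Algebra F B] (f : A →ₐ[F] B) (c r : ℕ) (P : Fin r → A)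
    (x : ↥(⋀[F]^r (Sym' F c))) : Psi c r (fun a => f (P a)) x = f (Psi c r P x) := by
  have : Psi c r (fun a => f (P a)) = f.toLinearMap ∘ₗ Psi c r P := by
    apply ((symB F c).exteriorPower r).ext
    intro s
    rw [wedgeB_apply, LinearMap.comp_apply, Psi_wedge _ _ _ _ (by intro a; omega),
      Psi_wedge _ _ _ _ (by intro a; omega), AlgHom.toLinearMap_apply, AlgHom.map_det]
    congr 1
    ext
    simp
  rw [this]; rfl

lemma coeff_alternant (r : ℕ) (k k' : Fin r → ℕ) (hk : StrictMono k) (hk' : StrictMono k') :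
    coeff (Finsupp.equivFunOnFinite.symm k')
      (Matrix.of fun b a => (X a : MvPolynomial (Fin r) F) ^ k b).det =
      if k = k' then 1 else 0 := by
  rw [Matrix.det_apply]
  simp only [Matrix.of_apply]
  have hprod : ∀ σ : Equiv.Perm (Fin r), ∏ i, (X i : MvPolynomial (Fin r) F) ^ k (σ i) =
      monomial (Finsupp.equivFunOnFinite.symm (k ∘ σ)) 1 := by
    intro σ
    rw [monomial_eq, Finsupp.prod_fintype _ _ (by simp)]
    simp
  rw [coeff_sum, Finset.sum_eq_single 1]
  · rw [hprod]
    simp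
  · intro σ _ hσ
    rw [hprod, Units.smul_def, coeff_smul, coeff_monomial, if_neg, smul_zero]
    intro h
    apply hσ
    have h1 : k ∘ σ = k' := Finsupp.equivFunOnFinite.symm.injective h
    have h2 : StrictMono σ := by
      intro a b hab
      have := hk' hab
      rw [← h1] at this
      exact hk.lt_iff_lt.1 this
    have h3 : (σ : Fin r → Fin r) = id :=
      Set.range_injOn_strictMono h2 strictMono_id (by simp)
    ext i
    simp [h3]
  · simp

lemma Psi_X_injective (c r : ℕ) :
    Function.Injective (Psi (F := F) c r (X : Fin r → MvPolynomial (Fin r) F)) := by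
  set b := (symB F c).exteriorPower r
  have hli : LinearIndependent F (fun s => Psi (F := F) c r
      (X : Fin r → MvPolynomial (Fin r) F) (b s)) := by
    have key : ∀ s t : Set.powersetCard (Fin (c + 1)) r, coeff (Finsupp.equivFunOnFinite.symm
        (fun a => (Set.powersetCard.ofFinEmbEquiv.symm s a : ℕ)))
        (Psi (F := F) c r (X : Fin r → MvPolynomial (Fin r) F) (b t)) =
        if t = s then 1 else 0 := by
      intro s t
      rw [wedgeB_apply, Psi_wedge _ _ _ _ (by intro a; omega), coeff_alternant]
      · congr 1
        rw [eq_iff_iff]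
        constructor
        · intro h
          apply Set.powersetCard.ofFinEmbEquiv.symm.injective
          ext a
          exact congrFun h a
        · rintro rfl; rfl
      · intro x y hxy; exact (Set.powersetCard.ofFinEmbEquiv.symm t).strictMono hxy
      · intro x y hxy; exact (Set.powersetCard.ofFinEmbEquiv.symm s).strictMono hxy
    refine LinearIndependent.of_pairwise_dual_eq_zero_one _
      (fun s => (MvPolynomial.lcoeff F (Finsupp.equivFunOnFinite.symm
        (fun a => (Set.powersetCard.ofFinEmbEquiv.symm s a : ℕ))))) ?_ ?_
    · intro s t hst
      exact (key s t).trans (if_neg (Ne.symm hst))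
    · intro s
      exact (key s s).trans (if_pos rfl)
  rw [injective_iff_map_eq_zero]
  intro x hx
  rw [← b.sum_repr x] at hx ⊢
  rw [map_sum] at hx
  simp only [map_smul] at hx
  have := Fintype.linearIndependent_iff.1 hli _ hx
  simp [this]

/-- Evaluation of `⋀^N Sym^d E ⊗ Sym^d E` at points `Q` and `z`. -/
def PsiCod (N d : ℕ) (Q : Fin N → A) (z : A) : Cod F N d →ₗ[F] A :=
  LinearMap.mul' F A ∘ₗ TensorProduct.map (Psi d N Q) (ev d z)

lemma PsiCod_tmul (N d : ℕ) (Q : Fin N → A) (z : A) (w : ↥(⋀[F]^N (Sym' F d))) (v : Sym' F d) :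
    PsiCod N d Q z (w ⊗ₜ[F] v) = Psi d N Q w * ev d z v := by
  simp [PsiCod]

/-- Evaluation of the domain of `φ` at points `z` and `Q`. -/
def PsiDom (N d : ℕ) (Q : Fin N → A) (z : A) : Dom F N d →ₗ[F] A :=
  LinearMap.mul' F A ∘ₗ TensorProduct.map (ev (N - 1) z)
    (Psi (d + 1) (N + 1) (Fin.cons z Q : Fin (N + 1) → A))

lemma PsiDom_tmul (N d : ℕ) (Q : Fin N → A) (z : A) (v : Sym' F (N - 1))
    (w : ↥(⋀[F]^(N + 1) (Sym' F (d + 1)))) :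
    PsiDom N d Q z (v ⊗ₜ[F] w) =
      ev (N - 1) z v * Psi (d + 1) (N + 1) (Fin.cons z Q : Fin (N + 1) → A) w := by
  simp [PsiDom]

lemma key_identity (N d : ℕ) (hN : 0 < N)
    (φ : Dom F N d →ₗ[F] Cod F N d)
    (hφ : ∀ s < N, ∀ k : Fin (N + 1) → ℕ, StrictMono k → (∀ a, k a ≤ d + 1) →
      φ (XY F (N - 1) s ⊗ₜ[F] wedge F (d + 1) k) = vv F d N s k)
    (Q : Fin N → A) (z : A) (x : Dom F N d) :
    PsiDom N d Q z x = (∏ c, (Q c - z)) * PsiCod N d Q z (φ x) := by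
  have : PsiDom N d Q z = (LinearMap.mulLeft F (∏ c, (Q c - z))) ∘ₗ PsiCod N d Q z ∘ₗ φ := by
    apply ((symB F (N - 1)).tensorProduct ((symB F (d + 1)).exteriorPower (N + 1))).ext
    rintro ⟨s, t⟩
    rw [Module.Basis.tensorProduct_apply, wedgeB_apply, symB_apply]
    set k : Fin (N + 1) → ℕ := fun a => (Set.powersetCard.ofFinEmbEquiv.symm t a : ℕ) with hkdef
    have hk : StrictMono k := fun x y hxy =>
      (Set.powersetCard.ofFinEmbEquiv.symm t).strictMono hxy
    have hkd : ∀ a, k a ≤ d + 1 := by intro a; simp only [hkdef]; omega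
    clear_value k
    rw [LinearMap.comp_apply, LinearMap.comp_apply, hφ s (by omega) k hk hkd, PsiDom_tmul,
      ev_XY _ _ (by omega), Psi_wedge _ _ _ _ hkd, key_det N k hk, LinearMap.mulLeft_apply, vv,
      map_sum, mul_left_comm, Finset.mul_sum]
    congr 1
    apply Finset.sum_congr rfl
    intro i hi
    have hi1 : ∀ b, k b.castSucc ≤ i b ∧ i b < k b.succ := by
      intro b
      have := Fintype.mem_piFinset.1 hi b
      exact (Finset.mem_Ico.1 this)
    have hid : ∀ b, i b ≤ d := by
      intro b
      have := (hi1 b).2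
      have := hkd b.succ
      omega
    have hA : ∑ a, k a ≤ ∑ b, i b + k (Fin.last N) := by
      rw [Fin.sum_univ_castSucc]
      exact Nat.add_le_add_right (Finset.sum_le_sum fun b _ => (hi1 b).1) _
    have hB : N + ∑ b, i b ≤ ∑ a, k a := by
      rw [Fin.sum_univ_succ]
      have : ∑ b : Fin N, (1 + i b) ≤ ∑ b : Fin N, k b.succ :=
        Finset.sum_le_sum fun b _ => by have := (hi1 b).2; omega
      rw [Finset.sum_add_distrib] at this
      simp at this
      omega
    have hL := hkd (Fin.last N)
    have hs := s.2
    rw [Fp, PsiCod_tmul, Psi_wedge _ _ _ _ hid, ev_XY _ _ (by omega), ← mul_assoc, ← pow_add,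
      mul_comm]
    congr 2
    omega
  rw [this]; rfl

lemma Psi_perm (c r : ℕ) (P : Fin r → A) (σ : Equiv.Perm (Fin r)) (x : ↥(⋀[F]^r (Sym' F c))) :
    Psi c r (P ∘ σ) x = ((Equiv.Perm.sign σ : ℤ) : A) * Psi c r P x := by
  have : Psi c r (P ∘ σ) = LinearMap.mulLeft F ((Equiv.Perm.sign σ : ℤ) : A) ∘ₗ Psi c r P := by
    apply exteriorPower.linearMap_ext
    ext v
    simp only [LinearMap.compAlternatingMap_apply, LinearMap.comp_apply, Psi_iMulti,
      LinearMap.mulLeft_apply]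
    rw [← Matrix.det_permute']
    rfl
  rw [this]; rfl

lemma Psi_cons (c N : ℕ) (P : Fin (N + 1) → A) (a : Fin (N + 1))
    (x : ↥(⋀[F]^(N + 1) (Sym' F c))) :
    Psi c (N + 1) (Fin.cons (P a) (fun b => P (a.succAbove b)) : Fin (N + 1) → A) x =
      (-1) ^ (a : ℕ) * Psi c (N + 1) P x := by
  have := Fin.cons_removeNth_eq_comp_cycleRange_symm P a
  have h2 : (Fin.cons (P a) (fun b => P (a.succAbove b)) : Fin (N + 1) → A) =
    P ∘ a.cycleRange.symm := this
  rw [h2, Psi_perm]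
  simp

lemma Psi_mu (d N : ℕ) (P : Fin (N + 1) → A) (y : Cod F N d) :
    Psi d (N + 1) P (mu F d N y) =
      ∑ a : Fin (N + 1), (-1) ^ (N + (a : ℕ)) *
        PsiCod N d (fun b => P (a.succAbove b)) (P a) y := by
  induction y using TensorProduct.induction_on with
  | zero => simp
  | add y z hy hz => simp [hy, hz, mul_add, Finset.sum_add_distrib]
  | tmul w v =>
    have : (Psi d (N + 1) P ∘ₗ mu F d N) ∘ₗ (TensorProduct.mk F _ _).flip v =
        (∑ a : Fin (N + 1), LinearMap.mulLeft F ((-1) ^ (N + (a : ℕ))) ∘ₗ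
          PsiCod N d (fun b => P (a.succAbove b)) (P a)) ∘ₗ (TensorProduct.mk F _ _).flip v := by
      apply exteriorPower.linearMap_ext
      ext u
      simp only [LinearMap.compAlternatingMap_apply, LinearMap.comp_apply, LinearMap.flip_apply,
        TensorProduct.mk_apply, LinearMap.sum_apply, LinearMap.mulLeft_apply, PsiCod_tmul,
        Psi_iMulti]
      have hmu : mu F d N (exteriorPower.ιMulti F N u ⊗ₜ[F] v) =
          exteriorPower.ιMulti F (N + 1) (Fin.snoc u v : Fin (N + 1) → Sym' F d) := by
        apply Subtype.ext
        simp only [mu, TensorProduct.lift.tmul, LinearMap.mk₂_apply,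
          exteriorPower.ιMulti_apply_coe, ExteriorAlgebra.ιMulti_apply]
        rw [List.ofFn_succ', List.concat_eq_append, List.prod_append]
        simp
      rw [hmu, Psi_iMulti, Matrix.det_succ_row _ (Fin.last N)]
      apply Finset.sum_congr rfl
      intro a _
      have h1 : ((Matrix.of fun b a => ev d (P a) ((Fin.snoc u v : Fin (N + 1) → Sym' F d) b)).submatrix
          (Fin.last N).succAbove a.succAbove) =
          (Matrix.of fun b c => ev d (P (a.succAbove c)) (u b)) := by
        ext b c
        simp
      rw [h1]
      simp only [Matrix.of_apply, Fin.snoc_last, Fin.val_last]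
      ring
    have := LinearMap.congr_fun this w
    simpa using this

lemma lagrange_zero {K : Type*} [Field K] (N s : ℕ) (hs : s < N) (P : Fin (N + 1) → K)
    (hP : Function.Injective P) :
    ∑ a : Fin (N + 1), P a ^ s / ∏ b : Fin N, (P (a.succAbove b) - P a) = 0 := by
  have h := Lagrange.coeff_eq_sum (s := (Finset.univ : Finset (Fin (N + 1)))) (v := P)
    hP.injOn (P := (Polynomial.X ^ s : Polynomial K)) (by
      rw [Polynomial.degree_X_pow]; simp; norm_cast; omega)
  rw [Polynomial.coeff_X_pow, if_neg (by simp; omega)] at h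
  have h2 : ∀ a : Fin (N + 1), ∏ b : Fin N, (P (a.succAbove b) - P a) =
      (-1) ^ N * ∏ j ∈ Finset.univ.erase a, (P a - P j) := by
    intro a
    have h3 : (Finset.univ.erase a : Finset (Fin (N + 1))) = Finset.univ.map a.succAboveEmb := by
      ext j
      simp [Fin.exists_succAbove_eq_iff]
    rw [h3, Finset.prod_map]
    have : ((-1 : K)) ^ N = ∏ b : Fin N, (-1 : K) := by simp
    rw [this, ← Finset.prod_mul_distrib]
    apply Finset.prod_congr rfl
    intro b _
    simp
  simp only [h2]
  simp only [Polynomial.eval_pow, Polynomial.eval_X] at h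
  have : ∀ a, P a ^ s / ((-1) ^ N * ∏ j ∈ Finset.univ.erase a, (P a - P j)) =
      ((-1) ^ N)⁻¹ * (P a ^ s / ∏ j ∈ Finset.univ.erase a, (P a - P j)) := by
    intro a
    rw [div_mul_eq_div_div, div_right_comm, div_eq_inv_mul]
  simp only [this]
  rw [← Finset.mul_sum, ← h, mul_zero]

lemma tensor_decomp_right {ι V W : Type*} [Fintype ι] [AddCommGroup V] [Module F V]
    [AddCommGroup W] [Module F W] (b : Module.Basis ι F V) (x : W ⊗[F] V) :
    ∃ w : ι → W, x = ∑ i, w i ⊗ₜ[F] b i := by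
  induction x using TensorProduct.induction_on with
  | zero => exact ⟨0, by simp⟩
  | add x y hx hy =>
    obtain ⟨w, rfl⟩ := hx
    obtain ⟨w', rfl⟩ := hy
    exact ⟨w + w', by simp [TensorProduct.add_tmul, Finset.sum_add_distrib]⟩
  | tmul w v =>
    refine ⟨fun i => b.repr v i • w, ?_⟩
    conv_lhs => rw [← b.sum_repr v, TensorProduct.tmul_sum]
    exact Finset.sum_congr rfl fun i _ => (TensorProduct.smul_tmul _ _ _).symm

lemma tensor_decomp_left {ι V W : Type*} [Fintype ι] [AddCommGroup V] [Module F V]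
    [AddCommGroup W] [Module F W] (b : Module.Basis ι F V) (x : V ⊗[F] W) :
    ∃ w : ι → W, x = ∑ i, b i ⊗ₜ[F] w i := by
  induction x using TensorProduct.induction_on with
  | zero => exact ⟨0, by simp⟩
  | add x y hx hy =>
    obtain ⟨w, rfl⟩ := hx
    obtain ⟨w', rfl⟩ := hy
    exact ⟨w + w', by simp [TensorProduct.tmul_add, Finset.sum_add_distrib]⟩
  | tmul v w =>
    refine ⟨fun i => b.repr v i • w, ?_⟩
    conv_lhs => rw [← b.sum_repr v, TensorProduct.sum_tmul]
    exact Finset.sum_congr rfl fun i _ => TensorProduct.smul_tmul _ _ _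

lemma PsiCod_X_injective (N d : ℕ) : Function.Injective (PsiCod (F := F) N d
    (fun a => (X a.succ : MvPolynomial (Fin (N + 1)) F)) (X 0)) := by
  rw [injective_iff_map_eq_zero]
  intro y hy
  obtain ⟨w, rfl⟩ := tensor_decomp_right (symB F d) y
  apply Finset.sum_eq_zero
  intro i _
  have h1 := congrArg (finSuccEquiv F N) hy
  simp only [map_sum, PsiCod_tmul, symB_apply, map_mul, map_zero] at h1
  have h2 : ∀ j, finSuccEquiv F N (Psi d N (fun a => (X a.succ : MvPolynomial (Fin (N + 1)) F))
      (w j)) = Polynomial.C (Psi d N (X : Fin N → MvPolynomial (Fin N) F) (w j)) := by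
    intro j
    have ha := Psi_map (finSuccEquiv F N).toAlgHom d N
      (fun a => (X a.succ : MvPolynomial (Fin (N + 1)) F)) (w j)
    have hb := Psi_map (Polynomial.CAlgHom (R := F) (A := MvPolynomial (Fin N) F)) d N (X : Fin N → MvPolynomial (Fin N) F) (w j)
    have hc : (fun a : Fin N => (finSuccEquiv F N).toAlgHom (X a.succ)) =
        fun a => Polynomial.CAlgHom (R := F) (X a : MvPolynomial (Fin N) F) := by
      funext a
      exact finSuccEquiv_X_succ
    rw [hc] at ha
    exact ha.symm.trans hb
  have h3 : ∀ j : Fin (d + 1), finSuccEquiv F N (ev d (X 0) (XY F d j)) =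
      Polynomial.X ^ (j : ℕ) := by
    intro j
    rw [ev_XY _ _ (by omega), map_pow, finSuccEquiv_X_zero]
  simp only [h2, h3] at h1
  have h4 := congrArg (fun p => Polynomial.coeff p (i : ℕ)) h1
  simp only [Polynomial.finset_sum_coeff, Polynomial.coeff_C_mul, Polynomial.coeff_X_pow,
    Polynomial.coeff_zero] at h4
  rw [Finset.sum_eq_single i] at h4
  · have h5 : w i = 0 := by
      apply Psi_X_injective d N
      simpa using h4
    simp [h5]
  · intro j _ hj
    rw [if_neg (fun h => hj (Fin.ext h.symm)), mul_zero]
  · simp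

lemma PsiCod_map {B : Type*} [CommRing B] [Algebra F B] (f : A →ₐ[F] B) (N d : ℕ) (Q : Fin N → A)
    (z : A) (y : Cod F N d) : PsiCod N d (fun a => f (Q a)) (f z) y = f (PsiCod N d Q z y) := by
  induction y using TensorProduct.induction_on with
  | zero => simp
  | add y z hy hz => simp [hy, hz]
  | tmul w v =>
    rw [PsiCod_tmul, PsiCod_tmul, Psi_map, map_mul]
    congr 1
    have : ev d (f z) = f.toLinearMap ∘ₗ ev d z := by
      apply (symB F d).ext
      intro i
      rw [LinearMap.comp_apply, symB_apply, ev_XY _ _ (by omega), ev_XY _ _ (by omega)]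
      simp
    rw [this]; rfl

lemma exists_generic.{u} (F : Type u) [Field F] (N : ℕ) :
    ∃ (K : Type u) (_ : Field K) (_ : Algebra F K) (P : Fin (N + 1) → K),
      Function.Injective P ∧ (∀ a t, P a ≠ algebraMap F K t) ∧
      (∀ c, Function.Injective (Psi (F := F) c (N + 1) P)) ∧
      (∀ d, Function.Injective (PsiCod (F := F) N d (fun b => P b.succ) (P 0))) := by
  let R := MvPolynomial (Fin (N + 1)) F
  let K := FractionRing R
  let f : R →ₐ[F] K := IsScalarTower.toAlgHom F R K
  have hf : Function.Injective f := IsFractionRing.injective R K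
  refine ⟨K, inferInstance, inferInstance, fun a => f (X a), ?_, ?_, ?_, ?_⟩
  · exact hf.comp (X_injective)
  · intro a t h
    rw [← f.commutes] at h
    have h1 := hf h
    have h2 := congrArg (coeff (Finsupp.single a 1)) h1
    rw [MvPolynomial.algebraMap_eq, coeff_C, if_neg] at h2
    · simp [coeff_X] at h2
    · intro h; have := congrArg (fun f => f a) h; simp at this
  · intro c x y h
    rw [Psi_map, Psi_map] at h
    exact Psi_X_injective c (N + 1) (hf h)
  · intro d x y h
    rw [PsiCod_map f N d (fun a => (X a.succ : R)), PsiCod_map f N d (fun a => (X a.succ : R))] at h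
    exact PsiCod_X_injective N d (hf h)

lemma range_eq_ker_of_dim {U V W : Type*} [AddCommGroup U] [Module F U] [AddCommGroup V]
    [Module F V] [AddCommGroup W] [Module F W] [FiniteDimensional F V]
    (f : U →ₗ[F] V) (g : V →ₗ[F] W) (hf : Function.Injective f) (hg : Function.Surjective g)
    (hle : LinearMap.range f ≤ LinearMap.ker g)
    (hd : Module.finrank F W + Module.finrank F U = Module.finrank F V) :
    LinearMap.range f = LinearMap.ker g := by
  apply Submodule.eq_of_le_of_finrank_eq hle
  have e1 := LinearMap.finrank_range_add_finrank_ker g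
  rw [LinearMap.range_eq_top.2 hg, finrank_top] at e1
  rw [LinearMap.finrank_range_of_inj hf]
  omega

section Equivariance

variable {K : Type*} [Field K] [Algebra F K]

/-- Denominator of the Moebius action. -/
def den (g : Matrix (Fin 2) (Fin 2) F) (z : K) : K :=
  algebraMap F K (g 0 0) + algebraMap F K (g 1 0) * z

/-- The Moebius action. -/
def moeb (g : Matrix (Fin 2) (Fin 2) F) (z : K) : K :=
  (algebraMap F K (g 0 1) + algebraMap F K (g 1 1) * z) / den g z

lemma ev_rho (g : Matrix (Fin 2) (Fin 2) F) (c : ℕ) (z : K) (hz : den g z ≠ 0) (p : Sym' F c) :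
    ev c z (rhoSym F g c p) = den g z ^ c * ev c (moeb g z) p := by
  have : ev c z ∘ₗ rhoSym F g c = LinearMap.mulLeft F (den g z ^ c) ∘ₗ ev c (moeb g z) := by
    apply (symB F c).ext
    intro i
    rw [LinearMap.comp_apply, LinearMap.comp_apply, symB_apply, ev_XY _ _ (by omega)]
    have hi : (i : ℕ) ≤ c := by omega
    have h1 : aeval ![1, z] (subst F g (X 0)) = den g z := by
      simp [subst, den, Fin.sum_univ_two]
    have h2 : aeval ![1, z] (subst F g (X 1)) = den g z * moeb g z := by
      rw [moeb, mul_div_cancel₀ _ hz]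
      simp [subst, Fin.sum_univ_two]
    have h3 : ev c z (rhoSym F g c (XY F c i)) =
        aeval ![1, z] (subst F g (XY F c i : MvPolynomial (Fin 2) F)) := rfl
    rw [h3]
    simp only [XY, hi, dite_true, map_mul, map_pow, h1, h2, LinearMap.mulLeft_apply]
    rw [mul_pow, ← mul_assoc, ← pow_add, Nat.sub_add_cancel hi]
  exact LinearMap.congr_fun this p

lemma Psi_rho (g : Matrix (Fin 2) (Fin 2) F) (c r : ℕ) (P : Fin r → K)
    (hP : ∀ a, den g (P a) ≠ 0) (x : ↥(⋀[F]^r (Sym' F c))) :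
    Psi c r P (rhoW F c r (rhoSym F g c) x) =
      (∏ a, den g (P a)) ^ c * Psi c r (fun a => moeb g (P a)) x := by
  have : Psi c r P ∘ₗ rhoW F c r (rhoSym F g c) =
      LinearMap.mulLeft F ((∏ a, den g (P a)) ^ c) ∘ₗ Psi c r (fun a => moeb g (P a)) := by
    apply exteriorPower.linearMap_ext
    ext v
    simp only [LinearMap.compAlternatingMap_apply, LinearMap.comp_apply, LinearMap.mulLeft_apply]
    have h1 : rhoW F c r (rhoSym F g c) (exteriorPower.ιMulti F r v) =
        exteriorPower.ιMulti F r (fun a => rhoSym F g c (v a)) := by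
      apply Subtype.ext
      exact ExteriorAlgebra.map_apply_ιMulti _ _
    rw [h1, Psi_iMulti, Psi_iMulti, ← Finset.prod_pow, ← Matrix.det_mul_row]
    congr 1
    ext b a
    simp [ev_rho, hP]
  exact LinearMap.congr_fun this x

lemma PsiCod_rho (g : Matrix (Fin 2) (Fin 2) F) (N d : ℕ) (Q : Fin N → K) (z : K)
    (hQ : ∀ a, den g (Q a) ≠ 0) (hz : den g z ≠ 0) (y : Cod F N d) :
    PsiCod N d Q z (rhoCod F N d g y) = (∏ a, den g (Q a)) ^ d * den g z ^ d *
      PsiCod N d (fun a => moeb g (Q a)) (moeb g z) y := by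
  induction y using TensorProduct.induction_on with
  | zero => simp
  | add y z hy hz => simp only [map_add, hy, hz, mul_add]
  | tmul w v =>
    rw [rhoCod, TensorProduct.map_tmul, PsiCod_tmul, PsiCod_tmul, Psi_rho _ _ _ _ hQ,
      ev_rho _ _ _ hz]
    ring

lemma PsiDom_rho (g : Matrix (Fin 2) (Fin 2) F) (N d : ℕ) (Q : Fin N → K) (z : K)
    (hQ : ∀ a, den g (Q a) ≠ 0) (hz : den g z ≠ 0) (y : Dom F N d) :
    PsiDom N d Q z (rhoDom F N d g y) =
      (∏ a, den g (Q a)) ^ (d + 1) * den g z ^ (N - 1 + (d + 1)) *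
      PsiDom N d (fun a => moeb g (Q a)) (moeb g z) y := by
  induction y using TensorProduct.induction_on with
  | zero => simp
  | add y z hy hz => simp only [map_add, hy, hz, mul_add]
  | tmul w v =>
    rw [rhoDom, TensorProduct.map_tmul, PsiDom_tmul, PsiDom_tmul, Psi_rho _ _ _ _ ?_,
      ev_rho _ _ _ hz]
    · have : (fun a => moeb g ((Fin.cons z Q : Fin (N + 1) → K) a)) =
          (Fin.cons (moeb g z) (fun a => moeb g (Q a)) : Fin (N + 1) → K) := by
        ext a
        cases a using Fin.cases <;> simp
      rw [this, Fin.prod_univ_succ]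
      simp only [Fin.cons_zero, Fin.cons_succ]
      ring
    · intro a
      cases a using Fin.cases
      · simpa using hz
      · simpa using hQ _

lemma moeb_sub (g : Matrix (Fin 2) (Fin 2) F) (y z : K) (hy : den g y ≠ 0) (hz : den g z ≠ 0) :
    den g y * den g z * (moeb g y - moeb g z) = algebraMap F K g.det * (y - z) := by
  have h1 : den g y * moeb g y = algebraMap F K (g 0 1) + algebraMap F K (g 1 1) * y := by
    rw [moeb, mul_div_cancel₀ _ hy]
  have h2 : den g z * moeb g z = algebraMap F K (g 0 1) + algebraMap F K (g 1 1) * z := by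
    rw [moeb, mul_div_cancel₀ _ hz]
  have : den g y * den g z * (moeb g y - moeb g z) =
    den g z * (den g y * moeb g y) - den g y * (den g z * moeb g z) := by ring
  rw [this, h1, h2, Matrix.det_fin_two, den, den]
  simp only [map_sub, map_mul]
  ring

end Equivariance

end Helpers

/-- Corollary 3.1 of the paper. For any field `F`, the map `φ` is an
isomorphism of `GL₂(F)`-representations
`Sym^{N-1} E ⊗ ⋀^{N+1} Sym^{d+1} E ≅ det^N ⊗ Δ^{(2,1^{N-1})} Sym^d E`: it is an injective
linear map with range `Δ^{(2,1^{N-1})} Sym^d E = ker μ_N`, and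
`φ(g·x) = det(g)^N • (g·φ(x))` for every `g ∈ GL₂(F)`. -/
theorem statement18 (F : Type*) [Field F] (N d : ℕ) (hN : 0 < N)
    (φ : Dom F N d →ₗ[F] Cod F N d)
    (hφ : ∀ s < N, ∀ k : Fin (N + 1) → ℕ, StrictMono k → (∀ a, k a ≤ d + 1) →
      φ (XY F (N - 1) s ⊗ₜ[F] wedge F (d + 1) k) = vv F d N s k) :
    Function.Injective φ ∧
    LinearMap.range φ = LinearMap.ker (mu F d N) ∧
    ∀ g : Matrix.GeneralLinearGroup (Fin 2) F, ∀ x : Dom F N d,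
      φ (rhoDom F N d (g : Matrix (Fin 2) (Fin 2) F) x)
        = ((g : Matrix (Fin 2) (Fin 2) F).det) ^ N •
            rhoCod F N d (g : Matrix (Fin 2) (Fin 2) F) (φ x) := by
  obtain ⟨K, _, _, P, hPinj, hPF, hPsi, hCod⟩ := exists_generic F N
  have key := fun (Q : Fin N → K) (z : K) (x : Dom F N d) => key_identity N d hN φ hφ Q z x
  have hsub : ∀ (a : Fin (N + 1)) (b : Fin N), P (a.succAbove b) - P a ≠ 0 := by
    intro a b h
    exact Fin.succAbove_ne a b (hPinj (sub_eq_zero.1 h))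
  have hinj : Function.Injective φ := by
    rw [injective_iff_map_eq_zero]
    intro x hx
    obtain ⟨w, rfl⟩ := tensor_decomp_left (symB F (N - 1)) x
    have h1 : ∀ a : Fin (N + 1), ∑ s : Fin (N - 1 + 1), P a ^ (s : ℕ) *
        Psi (d + 1) (N + 1) P (w s) = 0 := by
      intro a
      have h2 := key (fun b => P (a.succAbove b)) (P a) (∑ i, symB F (N - 1) i ⊗ₜ[F] w i)
      rw [hx, map_zero, mul_zero, map_sum] at h2
      simp only [PsiDom_tmul, symB_apply, Psi_cons] at h2
      have h3 : ∀ s : Fin (N - 1 + 1), ev (N - 1) (P a) (XY F (N - 1) s) *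
          ((-1) ^ (a : ℕ) * Psi (d + 1) (N + 1) P (w s)) =
          (-1) ^ (a : ℕ) * (P a ^ (s : ℕ) * Psi (d + 1) (N + 1) P (w s)) := by
        intro s
        rw [ev_XY _ _ (by omega)]
        ring
      simp only [h3] at h2
      rw [← Finset.mul_sum] at h2
      exact (mul_eq_zero.1 h2).resolve_left (pow_ne_zero _ (by simp))
    have h4 := Matrix.eq_zero_of_forall_index_sum_pow_mul_eq_zero
      (f := fun s : Fin (N - 1 + 1) => P (Fin.castLE (by omega) s))
      (v := fun s => Psi (d + 1) (N + 1) P (w s))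
      (fun s t h => Fin.castLE_injective _ (hPinj h)) (fun j => h1 _)
    apply Finset.sum_eq_zero
    intro s _
    have h5 : w s = 0 := by
      apply hPsi (d + 1)
      rw [map_zero]
      exact congrFun h4 s
    rw [h5, TensorProduct.tmul_zero]
  have hle : LinearMap.range φ ≤ LinearMap.ker (mu F d N) := by
    rintro _ ⟨x, rfl⟩
    rw [LinearMap.mem_ker]
    obtain ⟨w, rfl⟩ := tensor_decomp_left (symB F (N - 1)) x
    rw [map_sum, map_sum]
    apply Finset.sum_eq_zero
    intro s _
    apply hPsi d
    rw [map_zero, Psi_mu]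
    have h1 : ∀ a : Fin (N + 1), (-1) ^ (N + (a : ℕ)) *
        PsiCod N d (fun b => P (a.succAbove b)) (P a) (φ (symB F (N - 1) s ⊗ₜ[F] w s)) =
        ((-1) ^ N * Psi (d + 1) (N + 1) P (w s)) *
          (P a ^ (s : ℕ) / ∏ b : Fin N, (P (a.succAbove b) - P a)) := by
      intro a
      have h2 := key (fun b => P (a.succAbove b)) (P a) (symB F (N - 1) s ⊗ₜ[F] w s)
      rw [PsiDom_tmul, Psi_cons, symB_apply, ev_XY _ _ (by omega)] at h2
      have h3 : ∏ b : Fin N, (P (a.succAbove b) - P a) ≠ 0 :=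
        Finset.prod_ne_zero_iff.2 fun b _ => hsub a b
      rw [← symB_apply, mul_comm (∏ b : Fin N, (P (a.succAbove b) - P a)), ← div_eq_iff h3] at h2
      rw [← h2, pow_add]
      have h4 : ((-1 : K) ^ (a : ℕ)) * (-1) ^ (a : ℕ) = 1 := by
        rw [← mul_pow]; simp
      linear_combination ((-1 : K) ^ N * P a ^ (s : ℕ) * Psi (d + 1) (N + 1) P (w s) /
        ∏ b : Fin N, (P (a.succAbove b) - P a)) * h4
    simp only [h1]
    rw [← Finset.mul_sum, lagrange_zero N s (by omega) P hPinj, mul_zero]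
  refine ⟨hinj, ?_, ?_⟩
  · have hfin : ∀ c, Module.Finite F (Sym' F c) := fun c => Module.Finite.of_basis (symB F c)
    have hrk : ∀ c, Module.finrank F (Sym' F c) = c + 1 := fun c => by
      rw [Module.finrank_eq_card_basis (symB F c), Fintype.card_fin]
    have hsurj : Function.Surjective (mu F d N) := by
      rw [← LinearMap.range_eq_top, eq_top_iff, ← exteriorPower.ιMulti_span, Submodule.span_le]
      rintro _ ⟨v, rfl⟩
      refine ⟨exteriorPower.ιMulti F N (fun a => v a.castSucc) ⊗ₜ[F] v (Fin.last N), ?_⟩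
      apply Subtype.ext
      simp only [mu, TensorProduct.lift.tmul, LinearMap.mk₂_apply,
        exteriorPower.ιMulti_apply_coe, ExteriorAlgebra.ιMulti_apply]
      rw [List.ofFn_succ', List.concat_eq_append, List.prod_append]
      simp
    refine range_eq_ker_of_dim (U := Dom F N d) (V := Cod F N d) φ (mu F d N) hinj hsurj hle ?_
    rw [Module.finrank_tensorProduct, Module.finrank_tensorProduct, exteriorPower.finrank_eq,
      exteriorPower.finrank_eq, exteriorPower.finrank_eq, hrk, hrk, hrk, Nat.sub_add_cancel hN]
    have e3 := Nat.add_one_mul_choose_eq (d + 1) N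
    have e4 : (d + 1 + 1).choose (N + 1) = (d + 1).choose N + (d + 1).choose (N + 1) :=
      Nat.choose_succ_succ _ _
    nlinarith
  · intro g x
    set g' : Matrix (Fin 2) (Fin 2) F := (g : Matrix (Fin 2) (Fin 2) F) with hg'
    have hdet : g'.det ≠ 0 := g.det_ne_zero
    have hden : ∀ a, den g' (P a) ≠ 0 := by
      intro a h
      rw [den] at h
      by_cases h0 : g' 1 0 = 0
      · rw [h0] at h
        simp only [map_zero, zero_mul, add_zero, map_eq_zero] at h
        apply hdet
        rw [Matrix.det_fin_two, h, h0]
        ring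
      · apply hPF a (-(g' 0 0) / g' 1 0)
        have h0' : algebraMap F K (g' 1 0) ≠ 0 := by simpa using h0
        rw [map_div₀, map_neg, eq_div_iff h0']
        linear_combination h
    apply hCod d
    have hprod : ∏ c : Fin N, (P c.succ - P 0) ≠ 0 :=
      Finset.prod_ne_zero_iff.2 fun b _ => by simpa using hsub 0 b
    apply mul_left_cancel₀ hprod
    rw [← key, PsiDom_rho _ _ _ _ _ (fun a => hden _) (hden 0), key, map_smul,
      PsiCod_rho _ _ _ _ _ (fun a => hden _) (hden 0), Algebra.smul_def, map_pow]
    have hm : (∏ c : Fin N, den g' (P c.succ)) * den g' (P 0) ^ N *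
        ∏ c : Fin N, (moeb g' (P c.succ) - moeb g' (P 0)) =
        algebraMap F K g'.det ^ N * ∏ c : Fin N, (P c.succ - P 0) := by
      have c1 : den g' (P 0) ^ N = ∏ c : Fin N, den g' (P 0) := by simp
      have c2 : algebraMap F K g'.det ^ N = ∏ c : Fin N, algebraMap F K g'.det := by simp
      rw [c1, c2, ← Finset.prod_mul_distrib, ← Finset.prod_mul_distrib, ← Finset.prod_mul_distrib]
      exact Finset.prod_congr rfl fun c _ => moeb_sub g' _ _ (hden _) (hden 0)
    have hNd : N - 1 + (d + 1) = N + d := by omega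
    rw [hNd, pow_add, pow_succ]
    linear_combination ((∏ c : Fin N, den g' (P c.succ)) ^ d * den g' (P 0) ^ d *
      PsiCod N d (fun a => moeb g' (P (Fin.succ a))) (moeb g' (P 0)) (φ x)) * hm

end
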